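/- arXiv:1403.6952 — 6 statements merged into one kernel-verified Lean document; each statement's English description precedes it below -/
import Mathlib

section
/- Static strict feasibility under the cut-capacity condition: Let 𝒢 be a connected oriented graph with incidence matrix B, capacities λ̄_k ∈ (0,∞] for each edge k, and let b ∈ ℝ^n satisfy 1_nᵀ b = 0. Suppose there exists ε > 0 such that for every nonempty proper subset S ⊂ V one has |Σ_{i∈S} b_i| ≤ λ̄_{Q(S)} − ε (with the inequality understood in the extended reals). Then there exists a flow vector λ ∈ ℝ^m with B λ = −b and −λ̄_k < λ_k < λ̄_k for every edge k. -/
open Matrix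
open scoped ENNReal

open Finset in
/-- Discrete coarea inequality: if the cut capacities dominate the set function `S ↦ ∑ i ∈ S, a i`,
then the weighted total variation of `y` dominates `∑ i, a i * y i`. -/
theorem sum_mul_le_sum_mul_abs_sub_of_cut {V E : Type*} [Fintype V] [DecidableEq V] [Fintype E]
    (src dst : E → V) (c : E → ℝ) (a : V → ℝ) (ha : ∑ i, a i = 0)
    (hcut : ∀ S : Finset V, S.Nonempty → S ≠ univ →
      ∑ i ∈ S, a i ≤ ∑ k with (src k ∈ S ∧ dst k ∉ S) ∨ (src k ∉ S ∧ dst k ∈ S), c k)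
    (y : V → ℝ) :
    ∑ i, a i * y i ≤ ∑ k, c k * |y (src k) - y (dst k)| := by
  induction hN : (univ.image y).card using Nat.strong_induction_on generalizing y with
  | _ N ih =>
  by_cases hconst : ∀ i j, y i = y j
  · have hl : ∑ i, a i * y i = 0 := by
      rcases isEmpty_or_nonempty V with _ | ⟨⟨i₀⟩⟩
      · simp
      · rw [sum_congr rfl fun i _ => by rw [hconst i i₀], ← sum_mul, ha, zero_mul]
    have hr : ∑ k, c k * |y (src k) - y (dst k)| = 0 :=
      sum_eq_zero fun k _ => by rw [hconst (src k) (dst k)]; simp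
    rw [hl, hr]
  · push Not at hconst
    obtain ⟨i₁, i₂, hne⟩ := hconst
    obtain ⟨p, -, hp⟩ := exists_max_image univ y ⟨i₁, mem_univ _⟩
    have hlow : (univ.filter fun i => y i ≠ y p).Nonempty := by
      by_contra h
      rw [not_nonempty_iff_eq_empty, filter_eq_empty_iff] at h
      have h₁ := h (mem_univ i₁)
      have h₂ := h (mem_univ i₂)
      push Not at h₁ h₂
      exact hne (h₁.trans h₂.symm)
    obtain ⟨q, hqm, hq⟩ := exists_max_image _ y hlow
    have hqp : y q ≠ y p := (mem_filter.1 hqm).2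
    have hlt : y q < y p := lt_of_le_of_ne (hp q (mem_univ _)) hqp
    set S : Finset V := univ.filter fun i => y i = y p with hS
    have hmem : ∀ i, i ∈ S ↔ y i = y p := fun i => by simp [hS]
    have htop : ∀ i, i ∈ S → min (y i) (y q) = y q := fun i hi => by
      rw [(hmem i).1 hi]; exact min_eq_right hlt.le
    have hle : ∀ i, i ∉ S → y i ≤ y q := fun i hi =>
      hq i (mem_filter.2 ⟨mem_univ _, fun h => hi ((hmem i).2 h)⟩)
    have hbot : ∀ i, i ∉ S → min (y i) (y q) = y i := fun i hi => min_eq_left (hle i hi)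
    have hcard : (univ.image fun i => min (y i) (y q)).card < N := by
      rw [← hN]
      refine card_lt_card (ssubset_of_subset_of_ne ?_ ?_)
      · intro x hx
        obtain ⟨i, -, rfl⟩ := mem_image.1 hx
        rcases min_choice (y i) (y q) with h | h <;> simp [h]
      · intro h
        have : y p ∈ univ.image fun i => min (y i) (y q) := by rw [h]; simp
        obtain ⟨i, -, hi⟩ := mem_image.1 this
        exact absurd hi (ne_of_lt ((min_le_right _ _).trans_lt hlt))
    have hrec := ih _ hcard (fun i => min (y i) (y q)) rfl
    have hSc := hcut S ⟨p, (hmem p).2 rfl⟩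
      (fun h => hqp ((hmem q).1 (h ▸ mem_univ q)))
    have hl : ∑ i, a i * y i =
        ∑ i, a i * min (y i) (y q) + (y p - y q) * ∑ i ∈ S, a i := by
      rw [hS, sum_filter, mul_sum, ← sum_add_distrib]
      refine sum_congr rfl fun i _ => ?_
      by_cases hi : i ∈ S
      · rw [htop i hi, if_pos ((hmem i).1 hi), (hmem i).1 hi]
        ring
      · rw [hbot i hi, if_neg fun h => hi ((hmem i).2 h), mul_zero, add_zero]
    have hr : ∑ k, c k * |y (src k) - y (dst k)| =
        ∑ k, c k * |min (y (src k)) (y q) - min (y (dst k)) (y q)| +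
        (y p - y q) *
          ∑ k with (src k ∈ S ∧ dst k ∉ S) ∨ (src k ∉ S ∧ dst k ∈ S), c k := by
      rw [sum_filter, mul_sum, ← sum_add_distrib]
      refine sum_congr rfl fun k _ => ?_
      by_cases hs : src k ∈ S <;> by_cases hd : dst k ∈ S
      · simp [hs, hd, (hmem _).1 hs, (hmem _).1 hd]
      · have := hle _ hd
        rw [htop _ hs, hbot _ hd, (hmem _).1 hs, abs_of_nonneg (by linarith),
          abs_of_nonneg (by linarith), if_pos (Or.inl ⟨hs, hd⟩)]
        ring
      · have := hle _ hs
        rw [htop _ hd, hbot _ hs, (hmem _).1 hd, abs_of_nonpos (by linarith),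
          abs_of_nonpos (by linarith), if_pos (Or.inr ⟨hs, hd⟩)]
        ring
      · simp [hs, hd, hbot]
    rw [hl, hr]
    exact add_le_add hrec (mul_le_mul_of_nonneg_left hSc (by linarith))

open Finset in
/-- Gale's feasibility theorem for undirected networks with finite capacities. -/
theorem exists_flow_of_cut {V E : Type*} [Fintype V] [DecidableEq V] [Fintype E]
    (src dst : E → V) (c : E → ℝ) (hc : ∀ k, 0 ≤ c k) (a : V → ℝ) (ha : ∑ i, a i = 0)
    (hcut : ∀ S : Finset V, S.Nonempty → S ≠ univ →
      ∑ i ∈ S, a i ≤ ∑ k with (src k ∈ S ∧ dst k ∉ S) ∨ (src k ∉ S ∧ dst k ∈ S), c k)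
    (B : Matrix V E ℝ) (hB : ∀ (y : V → ℝ) k, ∑ i, B i k * y i = y (src k) - y (dst k)) :
    ∃ l : E → ℝ, B.mulVec l = a ∧ ∀ k, |l k| ≤ c k := by
  have hcomp : IsCompact (B.mulVecLin '' Set.Icc (-c) c) :=
    isCompact_Icc.image B.mulVecLin.continuous_of_finiteDimensional
  have hconv : Convex ℝ (B.mulVecLin '' Set.Icc (-c) c) :=
    (convex_Icc _ _).linear_image B.mulVecLin
  by_cases hmem : a ∈ B.mulVecLin '' Set.Icc (-c) c
  · obtain ⟨l, hl, hla⟩ := hmem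
    exact ⟨l, hla, fun k => abs_le.2 ⟨hl.1 k, hl.2 k⟩⟩
  · exfalso
    obtain ⟨f, u, hfu, hua⟩ := geometric_hahn_banach_closed_point hconv hcomp.isClosed hmem
    set y : V → ℝ := fun i => f (Pi.single i 1)
    have hf : ∀ x : V → ℝ, f x = ∑ i, x i * y i := fun x => by
      conv_lhs => rw [pi_eq_sum_univ' x]
      simp [map_sum, y, smul_eq_mul]
    let l : E → ℝ := fun k => c k * SignType.sign (y (src k) - y (dst k))
    have hl : l ∈ Set.Icc (-c) c := by
      have habs : ∀ k, |l k| ≤ c k := fun k => by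
        rw [abs_mul, abs_of_nonneg (hc k)]
        refine mul_le_of_le_one_right (hc k) ?_
        rcases lt_trichotomy (y (src k) - y (dst k)) 0 with h | h | h <;> simp [h]
      exact ⟨fun k => (abs_le.1 (habs k)).1, fun k => (abs_le.1 (habs k)).2⟩
    have hval : f (B.mulVecLin l) = ∑ k, c k * |y (src k) - y (dst k)| := by
      rw [hf]
      simp only [Matrix.mulVecLin_apply, Matrix.mulVec, dotProduct, sum_mul]
      rw [sum_comm]
      refine sum_congr rfl fun k _ => ?_
      rw [← sign_mul_self (y (src k) - y (dst k)), ← hB y k, ← mul_assoc, mul_sum]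
      refine sum_congr rfl fun i _ => ?_
      simp only [l, hB]
      ring
    have h := sum_mul_le_sum_mul_abs_sub_of_cut src dst c a ha hcut y
    rw [← hval, ← hf] at h
    linarith [hfu _ ⟨l, hl, rfl⟩]

open Finset in
/-- Extended capacities can be shrunk to strictly smaller finite ones while keeping a family of
finite lower bounds on sums, provided these bounds hold with a uniform margin. -/
theorem exists_real_capacity_lt {E : Type*} [Fintype E] (C : E → ℝ≥0∞) (hC : ∀ k, 0 < C k)
    {ε M : ℝ} (hε : 0 < ε) (hM : 0 ≤ M) :
    ∃ c : E → ℝ, (∀ k, 0 ≤ c k) ∧ (∀ k, ENNReal.ofReal (c k) < C k) ∧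
      ∀ (Q : Finset E) (r : ℝ), r ≤ M → ENNReal.ofReal (r + ε) ≤ ∑ k ∈ Q, C k →
        r ≤ ∑ k ∈ Q, c k := by
  set δ : ℝ := ε / (Fintype.card E + 1) with hδ
  have hpos : (0 : ℝ) < Fintype.card E + 1 := by positivity
  have hδpos : 0 < δ := by positivity
  let c : E → ℝ := fun k => if C k = ⊤ then M else max ((C k).toReal - δ) 0
  have hc : ∀ k, 0 ≤ c k := fun k => by
    simp only [c]
    split_ifs
    exacts [hM, le_max_right _ _]
  refine ⟨c, hc, fun k => ?_, fun Q r hr hQ => ?_⟩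
  · by_cases hk : C k = ⊤
    · simp [hk]
    · have h0 : 0 < (C k).toReal := ENNReal.toReal_pos (hC k).ne' hk
      simp only [c, if_neg hk]
      rw [ENNReal.ofReal_lt_iff_lt_toReal (le_max_right _ _) hk]
      exact max_lt (by linarith) h0
  · by_cases htop : ∃ k ∈ Q, C k = ⊤
    · obtain ⟨k, hkQ, hk⟩ := htop
      calc r ≤ c k := by simpa [c, hk] using hr
        _ ≤ ∑ k ∈ Q, c k := single_le_sum (fun k _ => hc k) hkQ
    · push Not at htop
      have hsum : ∑ k ∈ Q, C k ≠ ⊤ := (ENNReal.sum_lt_top.2 fun k hk => (htop k hk).lt_top).ne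
      have h₁ : r + ε ≤ ∑ k ∈ Q, (C k).toReal := by
        rw [← ENNReal.toReal_sum htop]
        exact (ENNReal.ofReal_le_iff_le_toReal hsum).1 hQ
      have h₂ : ∑ k ∈ Q, ((C k).toReal - δ) ≤ ∑ k ∈ Q, c k := sum_le_sum fun k hk => by
        simp only [c, if_neg (htop k hk)]
        exact le_max_left _ _
      have h₃ : (Q.card : ℝ) * δ ≤ ε := by
        have hcard : (Q.card : ℝ) ≤ Fintype.card E + 1 := by
          exact_mod_cast (card_le_univ Q).trans (Nat.le_succ _)
        calc (Q.card : ℝ) * δ ≤ (Fintype.card E + 1) * δ := by gcongr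
          _ = ε := by rw [hδ]; field_simp
      rw [sum_sub_distrib, sum_const, nsmul_eq_mul] at h₂
      linarith

/-- Static strict feasibility under the cut-capacity condition. -/
theorem static_strict_feasibility {n m : ℕ}
    (src dst : Fin m → Fin n) (hloop : ∀ k, src k ≠ dst k)
    (hconn : ∀ i j : Fin n, Relation.ReflTransGen
      (fun a b => ∃ k, (src k = a ∧ dst k = b) ∨ (src k = b ∧ dst k = a)) i j)
    (B : Matrix (Fin n) (Fin m) ℝ)
    (hB : B = Matrix.of fun i k => if i = src k then (1 : ℝ) else if i = dst k then -1 else 0)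
    (lamBar : Fin m → ℝ≥0∞) (hcap : ∀ k, 0 < lamBar k)
    (b : Fin n → ℝ) (hbal : ∑ i, b i = 0)
    (ε : ℝ) (hε : 0 < ε)
    (hcut : ∀ S : Finset (Fin n), S.Nonempty → S ≠ Finset.univ →
      ENNReal.ofReal (|∑ i ∈ S, b i| + ε) ≤
        ∑ k ∈ Finset.univ.filter
          (fun k => (src k ∈ S ∧ dst k ∉ S) ∨ (src k ∉ S ∧ dst k ∈ S)), lamBar k) :
    ∃ lam : Fin m → ℝ, B.mulVec lam = -b ∧ ∀ k, ENNReal.ofReal |lam k| < lamBar k := by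
  obtain ⟨c, hc, hlt, hbound⟩ := exists_real_capacity_lt lamBar hcap hε
    (Finset.sum_nonneg fun i _ => abs_nonneg (b i))
  have hflow := exists_flow_of_cut src dst c hc (-b) (by simp [hbal]) ?_ B ?_
  · obtain ⟨l, hl, hlc⟩ := hflow
    exact ⟨l, hl, fun k => (ENNReal.ofReal_le_ofReal (hlc k)).trans_lt (hlt k)⟩
  · intro S hne huniv
    have habs : |∑ i ∈ S, b i| ≤ ∑ i, |b i| :=
      (Finset.abs_sum_le_sum_abs _ _).trans
        (Finset.sum_le_sum_of_subset_of_nonneg (Finset.subset_univ S) fun _ _ _ => abs_nonneg _)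
    have h := hbound _ _ habs (hcut S hne huniv)
    simp only [Pi.neg_apply, Finset.sum_neg_distrib]
    exact (neg_le_abs _).trans h
  · intro y k
    have hentry : ∀ i, B i k * y i =
        (if i = src k then y i else 0) - if i = dst k then y i else 0 := fun i => by
      have hne := hloop k
      rw [hB, Matrix.of_apply]
      by_cases h₁ : i = src k
      · simp [h₁, hne]
      · by_cases h₂ : i = dst k <;> simp [h₁, h₂, hne.symm]
    simp [hentry, Finset.sum_sub_distrib]
end

section
/- Existence of a continuous strictly feasible flow trajectory (Proposition 1, part (ii)): Let 𝒢 be a connected oriented graph with incidence matrix B and capacities λ̄_k ∈ (0,∞]. Let d : [0,∞) → ℝ^n be continuous with 1_nᵀ d(t) = 0 for all t ≥ 0, and suppose there exists ε > 0 such that for every t ≥ 0 and every nonempty proper subset S ⊂ V one has |Σ_{i∈S} d_i(t)| ≤ λ̄_{Q(S)} − ε. Then there exists a continuous function λ : [0,∞) → ℝ^m such that for all t ≥ 0: B λ(t) + d(t) = 0 and −λ̄_k < λ_k(t) < λ̄_k for every edge k. -/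
open Matrix
open scoped ENNReal

/-- The incidence matrix of the oriented multigraph with edges `src k ⟶ dst k`. -/
def orientedIncMatrix {ι κ : Type*} [DecidableEq ι] (src dst : κ → ι) : Matrix ι κ ℝ :=
  Matrix.of fun i k => if i = src k then (1 : ℝ) else if i = dst k then -1 else 0

/-- The edges with exactly one endpoint in `S`. -/
def inducedCut {ι κ : Type*} [DecidableEq ι] [Fintype κ] (src dst : κ → ι) (S : Finset ι) :
    Finset κ :=
  Finset.univ.filter fun k => (src k ∈ S ∧ dst k ∉ S) ∨ (src k ∉ S ∧ dst k ∈ S)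

/-- The incidence matrix together with the all-ones vector, as a map `(l, s) ↦ B l + s 1`. -/
noncomputable def augmentedIncMap {ι κ : Type*} [DecidableEq ι] [Fintype κ] (src dst : κ → ι) :
    (κ → ℝ) × ℝ →ₗ[ℝ] (ι → ℝ) :=
  (orientedIncMatrix src dst).mulVecLin.coprod (LinearMap.toSpanSingleton ℝ (ι → ℝ) 1)

section Network

variable {ι κ : Type*} [DecidableEq ι] [Fintype κ] {src dst : κ → ι}

lemma augmentedIncMap_apply (l : κ → ℝ) (s : ℝ) :
    augmentedIncMap src dst (l, s) = orientedIncMatrix src dst *ᵥ l + s • (1 : ι → ℝ) := by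
  simp [augmentedIncMap]

lemma dotProduct_orientedIncMatrix_mulVec [Fintype ι] (hloop : ∀ k, src k ≠ dst k)
    (p : ι → ℝ) (l : κ → ℝ) :
    p ⬝ᵥ (orientedIncMatrix src dst *ᵥ l) = ∑ k, (p (src k) - p (dst k)) * l k := by
  rw [dotProduct_mulVec]
  refine Finset.sum_congr rfl fun k _ => ?_
  congr 1
  have h : ∀ i, p i * orientedIncMatrix src dst i k
      = (if i = src k then p i else 0) - (if i = dst k then p i else 0) := by
    intro i
    have := (hloop k).symm
    simp only [orientedIncMatrix, of_apply]
    split_ifs <;> simp_all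
  simp [vecMul, dotProduct, h]

lemma orientedIncMatrix_mulVec_single [DecidableEq κ] (hloop : ∀ k, src k ≠ dst k) (k : κ) :
    orientedIncMatrix src dst *ᵥ Pi.single k 1
      = (Pi.single (src k) 1 - Pi.single (dst k) 1 : ι → ℝ) := by
  ext i
  have := (hloop k).symm
  simp only [mulVec_single_one, col_apply, orientedIncMatrix, of_apply, Pi.sub_apply,
    Pi.single_apply]
  split_ifs <;> simp_all

lemma single_sub_single_mem_range_mulVecLin (hloop : ∀ k, src k ≠ dst k) {i j : ι}
    (h : Relation.ReflTransGen
      (fun a b => ∃ k, (src k = a ∧ dst k = b) ∨ (src k = b ∧ dst k = a)) i j) :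
    (Pi.single i 1 - Pi.single j 1 : ι → ℝ) ∈
      LinearMap.range (orientedIncMatrix src dst).mulVecLin := by
  classical
  induction h with
  | refl => simp
  | @tail b c _ hbc ih =>
    have hstep : (Pi.single b 1 - Pi.single c 1 : ι → ℝ) ∈
        LinearMap.range (orientedIncMatrix src dst).mulVecLin := by
      obtain ⟨k, ⟨rfl, rfl⟩ | ⟨rfl, rfl⟩⟩ := hbc
      · exact ⟨Pi.single k 1, orientedIncMatrix_mulVec_single hloop k⟩
      · refine ⟨-Pi.single k 1, ?_⟩
        rw [map_neg, mulVecLin_apply, orientedIncMatrix_mulVec_single hloop k, neg_sub]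
    simpa using add_mem ih hstep

lemma augmentedIncMap_surjective [Fintype ι] [Nonempty ι] (hloop : ∀ k, src k ≠ dst k)
    (hconn : ∀ i j : ι, Relation.ReflTransGen
      (fun a b => ∃ k, (src k = a ∧ dst k = b) ∨ (src k = b ∧ dst k = a)) i j) :
    Function.Surjective (augmentedIncMap src dst) := by
  rw [← LinearMap.range_eq_top, eq_top_iff]
  have hone : (1 : ι → ℝ) ∈ LinearMap.range (augmentedIncMap src dst) :=
    ⟨(0, 1), by simp [augmentedIncMap_apply]⟩
  have hsub : ∀ i j : ι, (Pi.single i 1 - Pi.single j 1 : ι → ℝ) ∈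
      LinearMap.range (augmentedIncMap src dst) := fun i j => by
    obtain ⟨l, hl⟩ := single_sub_single_mem_range_mulVecLin hloop (hconn i j)
    exact ⟨(l, 0), by simpa [augmentedIncMap_apply] using hl⟩
  have hcard : (Fintype.card ι : ℝ) ≠ 0 := by simp
  have hsingle : ∀ i : ι, (Pi.single i 1 : ι → ℝ) ∈
      LinearMap.range (augmentedIncMap src dst) := fun i => by
    have h := Submodule.smul_mem _ (Fintype.card ι : ℝ)⁻¹
      (add_mem hone (sum_mem fun j (_ : j ∈ Finset.univ) => hsub i j))
    convert h using 1
    ext a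
    simp [Finset.sum_apply, Pi.single_apply]
  intro v _
  rw [pi_eq_sum_univ' v]
  exact sum_mem fun i _ => Submodule.smul_mem _ _ (hsingle i)

lemma augmentedIncMap_snd_eq_zero [Fintype ι] [Nonempty ι] (hloop : ∀ k, src k ≠ dst k)
    {l : κ → ℝ} {s : ℝ} (h : ∑ i, augmentedIncMap src dst (l, s) i = 0) : s = 0 := by
  have hB := dotProduct_orientedIncMatrix_mulVec hloop 1 l
  rw [one_dotProduct] at hB
  simpa [augmentedIncMap_apply, Finset.sum_add_distrib, hB] using h

/-- A strict cut condition controls every potential, by peeling off its top level set. -/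
lemma dotProduct_eq_zero_or_lt_of_cut [Fintype ι] {c : κ → ℝ} (hc : ∀ k, 0 ≤ c k)
    {d : ι → ℝ} (hbal : ∑ i, d i = 0)
    (hcut : ∀ S : Finset ι, S.Nonempty → S ≠ Finset.univ →
      |∑ i ∈ S, d i| < ∑ k ∈ inducedCut src dst S, c k) (p : ι → ℝ) :
    p ⬝ᵥ d = 0 ∨ p ⬝ᵥ d < ∑ k, c k * |p (src k) - p (dst k)| := by
  classical
  induction hN : (Finset.univ.image p).card using Nat.strong_induction_on generalizing p with
  | _ N ih =>
  rcases isEmpty_or_nonempty ι with hι | hι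
  · exact Or.inl (by simp [dotProduct])
  obtain ⟨i₀, hi₀⟩ := Finite.exists_max p
  let S : Finset ι := Finset.univ.filter fun i => p i = p i₀
  have hS : ∀ i, i ∈ S ↔ p i = p i₀ := by simp [S]
  by_cases hSu : S = Finset.univ
  · have hp : ∀ i, p i = p i₀ := fun i => (hS i).1 (hSu ▸ Finset.mem_univ i)
    left
    simp only [dotProduct, hp]
    rw [← Finset.mul_sum, hbal, mul_zero]
  obtain ⟨i₁, hi₁, hmax⟩ := Finset.exists_max_image Sᶜ p
    (by rwa [Finset.nonempty_iff_ne_empty, Ne, Finset.compl_eq_empty_iff])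
  rw [Finset.mem_compl, hS] at hi₁
  have hgap : 0 < p i₀ - p i₁ := sub_pos.2 (lt_of_le_of_ne (hi₀ i₁) hi₁)
  have hle : ∀ i, i ∉ S → p i ≤ p i₁ := fun i hi => hmax i (Finset.mem_compl.2 hi)
  let q : ι → ℝ := fun i => if i ∈ S then p i₁ else p i
  have hq : Finset.univ.image q ⊆ (Finset.univ.image p).erase (p i₀) := by
    intro x hx
    obtain ⟨i, -, rfl⟩ := Finset.mem_image.1 hx
    by_cases hi : i ∈ S
    · simp [q, hi, hi₁]
    · simpa [q, hi] using fun h => hi ((hS i).2 h)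
  have hcard : (Finset.univ.image q).card < N := hN ▸ (Finset.card_le_card hq).trans_lt
    (Finset.card_erase_lt_of_mem (Finset.mem_image_of_mem p (Finset.mem_univ i₀)))
  have hqle : q ⬝ᵥ d ≤ ∑ k, c k * |q (src k) - q (dst k)| := by
    rcases ih _ hcard q rfl with h | h
    · exact h.le.trans (Finset.sum_nonneg fun k _ => mul_nonneg (hc k) (abs_nonneg _))
    · exact h.le
  have hpd : p ⬝ᵥ d = q ⬝ᵥ d + (p i₀ - p i₁) * ∑ i ∈ S, d i := by
    have hsum : ∑ i ∈ S, d i = ∑ i, if i ∈ S then d i else 0 := by simp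
    rw [hsum]
    simp only [dotProduct, Finset.mul_sum, ← Finset.sum_add_distrib]
    refine Finset.sum_congr rfl fun i _ => ?_
    by_cases hi : i ∈ S
    · simp only [q, hi, if_true, (hS i).1 hi]
      ring
    · simp [q, hi]
  have hedge : ∀ k, |p (src k) - p (dst k)| = |q (src k) - q (dst k)|
      + if k ∈ inducedCut src dst S then p i₀ - p i₁ else 0 := by
    intro k
    by_cases h₁ : src k ∈ S <;> by_cases h₂ : dst k ∈ S
    · simp [inducedCut, q, h₁, h₂, (hS _).1 h₁, (hS _).1 h₂]
    · have := hle _ h₂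
      simp only [inducedCut, q, h₁, h₂, (hS _).1 h₁, Finset.mem_filter, Finset.mem_univ]
      simp only [not_false_eq_true, and_self, true_or, if_true, if_false]
      rw [abs_of_nonneg (by linarith), abs_of_nonneg (by linarith)]
      ring
    · have := hle _ h₁
      simp only [inducedCut, q, h₁, h₂, (hS _).1 h₂, Finset.mem_filter, Finset.mem_univ]
      simp only [not_false_eq_true, and_self, or_true, if_true, if_false]
      rw [abs_of_nonpos (by linarith), abs_of_nonpos (by linarith)]
      ring
    · simp [inducedCut, q, h₁, h₂]
  have hcap : ∑ k, c k * |p (src k) - p (dst k)| = ∑ k, c k * |q (src k) - q (dst k)|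
      + (p i₀ - p i₁) * ∑ k ∈ inducedCut src dst S, c k := by
    have hsum : ∑ k ∈ inducedCut src dst S, c k
        = ∑ k, if k ∈ inducedCut src dst S then c k else 0 := by simp
    rw [hsum, Finset.mul_sum, ← Finset.sum_add_distrib]
    refine Finset.sum_congr rfl fun k _ => ?_
    rw [hedge k]
    split_ifs <;> ring
  have hlt : ∑ i ∈ S, d i < ∑ k ∈ inducedCut src dst S, c k :=
    (le_abs_self _).trans_lt (hcut S ⟨i₀, (hS i₀).2 rfl⟩ hSu)
  right
  rw [hpd, hcap]
  exact add_lt_add_of_le_of_lt hqle (mul_lt_mul_of_pos_left hlt hgap)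

/-- A strict cut condition yields a strictly feasible flow. -/
lemma exists_flow_of_cut_s2 [Fintype ι] [Nonempty ι] (hloop : ∀ k, src k ≠ dst k)
    (hconn : ∀ i j : ι, Relation.ReflTransGen
      (fun a b => ∃ k, (src k = a ∧ dst k = b) ∨ (src k = b ∧ dst k = a)) i j)
    {c : κ → ℝ} (hc : ∀ k, 0 < c k) {d : ι → ℝ} (hbal : ∑ i, d i = 0)
    (hcut : ∀ S : Finset ι, S.Nonempty → S ≠ Finset.univ →
      |∑ i ∈ S, d i| < ∑ k ∈ inducedCut src dst S, c k) :
    ∃ l : κ → ℝ, orientedIncMatrix src dst *ᵥ l = d ∧ ∀ k, |l k| < c k := by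
  let U : Set ((κ → ℝ) × ℝ) := Set.univ.pi (fun k => Set.Ioo (-c k) (c k)) ×ˢ Set.univ
  have hUo : IsOpen U :=
    (isOpen_set_pi Set.finite_univ fun k _ => isOpen_Ioo).prod isOpen_univ
  have hUc : Convex ℝ U := (convex_pi fun k _ => convex_Ioo _ _).prod convex_univ
  have hmemU : ∀ l : κ → ℝ, (∀ k, |l k| < c k) → (l, (0 : ℝ)) ∈ U := fun l hl =>
    ⟨fun k _ => abs_lt.1 (hl k), trivial⟩
  by_cases hd : d ∈ augmentedIncMap src dst '' U
  · obtain ⟨⟨l, s⟩, ⟨hl, -⟩, hls⟩ := hd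
    have hs : s = 0 := augmentedIncMap_snd_eq_zero hloop (l := l) (by rw [hls, hbal])
    refine ⟨l, ?_, fun k => abs_lt.2 (hl k trivial)⟩
    rw [← hls, augmentedIncMap_apply, hs, zero_smul, add_zero]
  exfalso
  obtain ⟨f, hf⟩ := geometric_hahn_banach_open_point (hUc.linear_image _)
    ((augmentedIncMap src dst).isOpenMap_of_finiteDimensional
      (augmentedIncMap_surjective hloop hconn) _ hUo) hd
  let p : ι → ℝ := fun i => f (Pi.single i 1)
  have hfp : ∀ v, f v = p ⬝ᵥ v := fun v => by
    conv_lhs => rw [pi_eq_sum_univ' v, map_sum]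
    simp only [dotProduct, p, map_smul, smul_eq_mul]
    exact Finset.sum_congr rfl fun i _ => mul_comm _ _
  have hflow : ∀ l : κ → ℝ, (∀ k, |l k| < c k) →
      ∑ k, (p (src k) - p (dst k)) * l k < p ⬝ᵥ d := fun l hl => by
    have h := hf _ (Set.mem_image_of_mem _ (hmemU l hl))
    rwa [augmentedIncMap_apply, zero_smul, add_zero, hfp, hfp,
      dotProduct_orientedIncMatrix_mulVec hloop] at h
  have hpos : 0 < p ⬝ᵥ d := by simpa using hflow 0 (by simpa using hc)
  set M := ∑ k, c k * |p (src k) - p (dst k)| with hM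
  have hlt : p ⬝ᵥ d < M :=
    (dotProduct_eq_zero_or_lt_of_cut (fun k => (hc k).le) hbal hcut p).resolve_left hpos.ne'
  have hMpos : 0 < M := hpos.trans hlt
  have hr₀ : 0 ≤ p ⬝ᵥ d / M := by positivity
  have hr₁ : p ⬝ᵥ d / M < 1 := (div_lt_one hMpos).2 hlt
  refine (hflow (fun k => p ⬝ᵥ d / M * (c k * SignType.sign (p (src k) - p (dst k))))
    fun k => ?_).ne ?_
  · rw [abs_mul, abs_mul, abs_of_nonneg hr₀, abs_of_pos (hc k)]
    have hsign : |((SignType.sign (p (src k) - p (dst k)) : SignType) : ℝ)| ≤ 1 := by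
      rcases SignType.sign (p (src k) - p (dst k)) <;> simp
    have := mul_le_mul_of_nonneg_left hsign (mul_nonneg hr₀ (hc k).le)
    nlinarith [mul_lt_mul_of_pos_right hr₁ (hc k)]
  · have h : ∀ k, (p (src k) - p (dst k)) *
        (p ⬝ᵥ d / M * (c k * SignType.sign (p (src k) - p (dst k))))
        = p ⬝ᵥ d / M * (c k * |p (src k) - p (dst k)|) := fun k => by
      rw [← self_mul_sign]
      ring
    simp only [h]
    rw [← Finset.mul_sum, ← hM, div_mul_cancel₀ _ hMpos.ne']

/-- Infinite capacities can be replaced by large finite ones in the strict cut condition. -/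
lemma exists_flow_of_ennreal_cut [Fintype ι] [Nonempty ι] (hloop : ∀ k, src k ≠ dst k)
    (hconn : ∀ i j : ι, Relation.ReflTransGen
      (fun a b => ∃ k, (src k = a ∧ dst k = b) ∨ (src k = b ∧ dst k = a)) i j)
    {c : κ → ℝ≥0∞} (hc : ∀ k, 0 < c k) {d : ι → ℝ} (hbal : ∑ i, d i = 0)
    (hcut : ∀ S : Finset ι, S.Nonempty → S ≠ Finset.univ →
      ENNReal.ofReal |∑ i ∈ S, d i| < ∑ k ∈ inducedCut src dst S, c k) :
    ∃ l : κ → ℝ, orientedIncMatrix src dst *ᵥ l = d ∧ ∀ k, ENNReal.ofReal |l k| < c k := by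
  classical
  let M : ℝ := ∑ i, |d i| + 1
  have hM : 0 < M := by positivity
  let c' : κ → ℝ := fun k => if c k = ⊤ then M else (c k).toReal
  have hc' : ∀ k, 0 < c' k := fun k => by
    by_cases hk : c k = ⊤
    · simpa [c', hk] using hM
    · simpa [c', hk] using ENNReal.toReal_pos (hc k).ne' hk
  obtain ⟨l, hl, hlc⟩ := exists_flow_of_cut_s2 hloop hconn hc' hbal fun S hS hSu => by
    by_cases htop : ∃ k ∈ inducedCut src dst S, c k = ⊤
    · obtain ⟨k, hk, hkt⟩ := htop
      calc |∑ i ∈ S, d i| ≤ ∑ i ∈ S, |d i| := Finset.abs_sum_le_sum_abs _ _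
        _ ≤ ∑ i, |d i| := Finset.sum_le_univ_sum_of_nonneg fun i => abs_nonneg _
        _ < M := lt_add_one _
        _ = c' k := by simp [c', hkt]
        _ ≤ _ := Finset.single_le_sum (f := c') (fun k _ => (hc' k).le) hk
    · push Not at htop
      have h := hcut S hS hSu
      rw [← ENNReal.ofReal_toReal (ENNReal.sum_ne_top.2 htop), ENNReal.toReal_sum htop] at h
      refine (ENNReal.ofReal_lt_ofReal_iff'.1 h).1.trans_eq (Finset.sum_congr rfl fun k hk => ?_)
      simp [c', htop k hk]
  refine ⟨l, hl, fun k => ?_⟩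
  by_cases hk : c k = ⊤
  · simp [hk]
  · rw [← ENNReal.ofReal_toReal hk]
    exact (ENNReal.ofReal_lt_ofReal_iff_of_nonneg (abs_nonneg _)).2 (by simpa [c', hk] using hlc k)

/-- Strictly feasible flows for a continuously varying demand can be chosen continuously. -/
lemma exists_continuous_flow_of_cut [Fintype ι] [Nonempty ι] {X : Type*} [TopologicalSpace X]
    [NormalSpace X] [ParacompactSpace X] (hloop : ∀ k, src k ≠ dst k)
    (hconn : ∀ i j : ι, Relation.ReflTransGen
      (fun a b => ∃ k, (src k = a ∧ dst k = b) ∨ (src k = b ∧ dst k = a)) i j)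
    {c : κ → ℝ≥0∞} (hc : ∀ k, 0 < c k) {d : X → ι → ℝ} (hd : Continuous d)
    (hbal : ∀ x, ∑ i, d x i = 0)
    (hcut : ∀ x, ∀ S : Finset ι, S.Nonempty → S ≠ Finset.univ →
      ENNReal.ofReal |∑ i ∈ S, d x i| < ∑ k ∈ inducedCut src dst S, c k) :
    ∃ l : C(X, κ → ℝ), ∀ x, orientedIncMatrix src dst *ᵥ l x = d x ∧
      ∀ k, ENNReal.ofReal |l x k| < c k := by
  have hset : ∀ k, {y : ℝ | ENNReal.ofReal |y| < c k} =
      if c k = ⊤ then Set.univ else Metric.ball 0 (c k).toReal := fun k => by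
    ext y
    split_ifs with hk
    · simp [hk]
    · rw [Set.mem_ofPred_eq, ENNReal.ofReal_lt_iff_lt_toReal (abs_nonneg _) hk]
      simp
  have hconv : ∀ k, Convex ℝ {y : ℝ | ENNReal.ofReal |y| < c k} := fun k => by
    rw [hset]
    split_ifs
    exacts [convex_univ, convex_ball _ _]
  obtain ⟨R, hR⟩ := (augmentedIncMap src dst).exists_rightInverse_of_surjective
    (LinearMap.range_eq_top.2 (augmentedIncMap_surjective hloop hconn))
  have hRflow : ∀ v : ι → ℝ, ∑ i, v i = 0 → orientedIncMatrix src dst *ᵥ (R v).1 = v := by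
    intro v hv
    have h : augmentedIncMap src dst ((R v).1, (R v).2) = v := LinearMap.congr_fun hR v
    have hs := augmentedIncMap_snd_eq_zero hloop (l := (R v).1) (s := (R v).2) (by rw [h, hv])
    simpa [augmentedIncMap_apply, hs] using h
  refine exists_continuous_forall_mem_convex_of_local
    (t := fun x => {l : κ → ℝ | orientedIncMatrix src dst *ᵥ l = d x ∧
      ∀ k, ENNReal.ofReal |l k| < c k}) (fun x => ?_) fun x => ?_
  · rintro l ⟨hl, hlc⟩ l' ⟨hl', hlc'⟩ a b ha hb hab
    refine ⟨?_, fun k => hconv k (hlc k) (hlc' k) ha hb hab⟩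
    rw [mulVec_add, mulVec_smul, mulVec_smul, hl, hl', ← add_smul, hab, one_smul]
  · obtain ⟨l, hl, hlc⟩ := exists_flow_of_ennreal_cut hloop hconn hc (hbal x) (hcut x)
    let g : X → κ → ℝ := fun y => l + (R (d y - d x)).1
    have hg : Continuous g := continuous_const.add (continuous_fst.comp
      (R.continuous_of_finiteDimensional.comp (hd.sub continuous_const)))
    have hgx : g x = l := by simp [g]
    have hopen : IsOpen {y | ∀ k, ENNReal.ofReal |g y k| < c k} := by
      simp only [Set.ofPred_forall]
      exact isOpen_iInter_of_finite fun k => isOpen_lt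
        (ENNReal.continuous_ofReal.comp ((continuous_apply k).comp hg).abs) continuous_const
    refine ⟨_, hopen.mem_nhds fun k => by simpa [hgx] using hlc k, g, hg.continuousOn,
      fun y hy => ⟨?_, hy⟩⟩
    simp only [g]
    rw [mulVec_add, hl, hRflow _ (by simp [Finset.sum_sub_distrib, hbal]), add_sub_cancel]

end Network

/-- Existence of a continuous strictly feasible flow trajectory (Proposition 1, part (ii)). -/
theorem continuous_feasible_flow_trajectory {n m : ℕ}
    (src dst : Fin m → Fin n) (hloop : ∀ k, src k ≠ dst k)
    (hconn : ∀ i j : Fin n, Relation.ReflTransGen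
      (fun a b => ∃ k, (src k = a ∧ dst k = b) ∨ (src k = b ∧ dst k = a)) i j)
    (B : Matrix (Fin n) (Fin m) ℝ)
    (hB : B = Matrix.of fun i k => if i = src k then (1 : ℝ) else if i = dst k then -1 else 0)
    (lamBar : Fin m → ℝ≥0∞) (hcap : ∀ k, 0 < lamBar k)
    (d : ℝ → Fin n → ℝ)
    (hd : ContinuousOn d (Set.Ici (0 : ℝ)))
    (hbal : ∀ t ≥ (0 : ℝ), ∑ i, d t i = 0)
    (ε : ℝ) (hε : 0 < ε)
    (hcut : ∀ t ≥ (0 : ℝ), ∀ S : Finset (Fin n), S.Nonempty → S ≠ Finset.univ →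
      ENNReal.ofReal (|∑ i ∈ S, d t i| + ε) ≤
        ∑ k ∈ Finset.univ.filter
          (fun k => (src k ∈ S ∧ dst k ∉ S) ∨ (src k ∉ S ∧ dst k ∈ S)), lamBar k) :
    ∃ lam : ℝ → Fin m → ℝ, ContinuousOn lam (Set.Ici (0 : ℝ)) ∧
      ∀ t ≥ (0 : ℝ), B.mulVec (lam t) + d t = 0 ∧
        ∀ k, ENNReal.ofReal |lam t k| < lamBar k := by
  rcases isEmpty_or_nonempty (Fin n) with hn | hn
  · exact ⟨fun _ => 0, continuousOn_const, fun t _ =>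
      ⟨Subsingleton.elim _ _, fun k => hn.elim (src k)⟩⟩
  obtain ⟨l, hl⟩ := exists_continuous_flow_of_cut (X := ℝ) hloop hconn hcap
    (d := fun t => -d (max t 0))
    (hd.comp_continuous (continuous_id.max continuous_const) fun t => le_max_right t 0).neg
    (fun t => by simpa using hbal _ (le_max_right t 0)) fun t S hS hSu => by
      refine lt_of_lt_of_le ?_ (hcut _ (le_max_right t 0) S hS hSu)
      have hsum : |∑ i ∈ S, (-d (max t 0)) i| = |∑ i ∈ S, d (max t 0) i| := by
        simp
      rw [hsum]
      exact (ENNReal.ofReal_lt_ofReal_iff_of_nonneg (abs_nonneg _)).2 (lt_add_of_pos_right _ hε)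
  refine ⟨l, l.continuous.continuousOn, fun t ht => ⟨?_, (hl t).2⟩⟩
  have h : B *ᵥ l t = -d (max t 0) := hB ▸ (hl t).1
  rw [h, max_eq_left ht, neg_add_cancel]
end

section
/- Existence and uniqueness of the optimal flow for Legendre-type costs: Let B ∈ ℝ^{n×m}, b ∈ ℝ^n, and capacities λ̄_k ∈ (0,∞). For each k let 𝒫_k : (−λ̄_k, λ̄_k) → ℝ be strictly convex and differentiable with |𝒫_k'(λ^{(j)})| → ∞ for every sequence λ^{(j)} in (−λ̄_k, λ̄_k) with |λ^{(j)}| → λ̄_k. If the strictly feasible set F = { λ ∈ ℝ^m : Bλ = −b and |λ_k| < λ̄_k for all k } is nonempty, then the problem of minimizing Σ_{k=1}^m 𝒫_k(λ_k) over F has a unique minimizer λ* ∈ F. -/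
open Matrix

/-- A monotone function on a symmetric open interval whose absolute value blows up at the boundary
pairs arbitrarily negatively with the direction pointing back to a fixed interior point. -/
lemma exists_radius_mul_sub_lt {L : ℝ} {g : ℝ → ℝ} (hg : MonotoneOn g (Set.Ioo (-L) L))
    (hblow : ∀ xs : ℕ → ℝ, (∀ j, xs j ∈ Set.Ioo (-L) L) →
      Filter.Tendsto (fun j => |xs j|) Filter.atTop (nhds L) →
      Filter.Tendsto (fun j => |g (xs j)|) Filter.atTop Filter.atTop)
    {a : ℝ} (ha : |a| < L) (M : ℝ) :
    ∃ r < L, ∀ x ∈ Set.Ioo (-L) L, r ≤ |x| → g x * (a - x) < -M := by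
  by_contra! h
  have hr (j : ℕ) : L - 1 / ((j : ℝ) + 1) < L := sub_lt_self _ (by positivity)
  choose xs hxs hrx hM using fun j : ℕ => h _ (hr j)
  have hlim : Filter.Tendsto (fun j => |xs j|) Filter.atTop (nhds L) := by
    refine tendsto_of_tendsto_of_tendsto_of_le_of_le (g := fun j : ℕ => L - 1 / ((j : ℝ) + 1))
      ?_ tendsto_const_nhds hrx fun j => (abs_lt.2 (hxs j)).le
    simpa using (tendsto_one_div_add_atTop_nhds_zero_nat (𝕜 := ℝ)).const_sub L
  set d := (L - |a|) / 2 with hd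
  have hdpos : 0 < d := by linarith
  obtain ⟨j, hj, hgj⟩ := ((hlim.eventually_const_lt (show |a| + d < L by linarith)).and
    ((hblow xs hxs hlim).eventually_gt_atTop (max |g a| (|M| / d)))).exists
  obtain ⟨hga, hMd⟩ := max_lt_iff.1 hgj
  rw [div_lt_iff₀ hdpos] at hMd
  have hMj := hM j
  have hMabs := le_abs_self M
  have hdist : d < |a - xs j| := by
    have := abs_sub_abs_le_abs_sub (xs j) a
    rw [abs_sub_comm] at this
    linarith
  have haI : a ∈ Set.Ioo (-L) L := abs_lt.1 ha
  have hprod : |g (xs j)| * d ≤ |g (xs j)| * |a - xs j| := by gcongr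
  have hga₁ := neg_abs_le (g a)
  have hga₂ := le_abs_self (g a)
  rcases le_total a (xs j) with hax | hax
  · have hm := hg haI (hxs j) hax
    have hpos : 0 < g (xs j) := by
      by_contra! hn
      rw [abs_of_nonpos hn] at hga
      linarith
    rw [abs_of_pos hpos, abs_of_nonpos (sub_nonpos.2 hax)] at hprod
    rw [abs_of_pos hpos] at hMd
    linarith
  · have hm := hg (hxs j) haI hax
    have hneg : g (xs j) < 0 := by
      by_contra! hn
      rw [abs_of_nonneg hn] at hga
      linarith
    rw [abs_of_neg hneg, abs_of_nonneg (sub_nonneg.2 hax)] at hprod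
    rw [abs_of_neg hneg] at hMd
    linarith

/-- A separable sum of strictly convex functions is strictly convex. -/
lemma strictConvexOn_sum_apply {ι : Type*} [Fintype ι] {S : Set (ι → ℝ)} (hS : Convex ℝ S)
    {I : ι → Set ℝ} (hSI : ∀ x ∈ S, ∀ k, x k ∈ I k) {P : ι → ℝ → ℝ}
    (hP : ∀ k, StrictConvexOn ℝ (I k) (P k)) :
    StrictConvexOn ℝ S fun x => ∑ k, P k (x k) := by
  refine ⟨hS, fun x hx y hy hxy s t hs ht hst => ?_⟩
  obtain ⟨k, hk⟩ := Function.ne_iff.1 hxy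
  simp only [Finset.smul_sum, ← Finset.sum_add_distrib]
  exact Finset.sum_lt_sum
    (fun i _ => (hP i).convexOn.2 (hSI x hx i) (hSI y hy i) hs.le ht.le hst)
    ⟨k, Finset.mem_univ k, (hP k).2 (hSI x hx k) (hSI y hy k) hk hs ht hst⟩

/-- Existence and uniqueness of the optimal flow for Legendre-type costs. -/
theorem optimal_flow_exists_unique {n m : ℕ}
    (B : Matrix (Fin n) (Fin m) ℝ) (b : Fin n → ℝ)
    (lamBar : Fin m → ℝ) (hcap : ∀ k, 0 < lamBar k)
    (P P' : Fin m → ℝ → ℝ)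
    (hconv : ∀ k, StrictConvexOn ℝ (Set.Ioo (-(lamBar k)) (lamBar k)) (P k))
    (hderiv : ∀ k, ∀ x ∈ Set.Ioo (-(lamBar k)) (lamBar k), HasDerivAt (P k) (P' k x) x)
    (hblow : ∀ k, ∀ xs : ℕ → ℝ, (∀ j, xs j ∈ Set.Ioo (-(lamBar k)) (lamBar k)) →
      Filter.Tendsto (fun j => |xs j|) Filter.atTop (nhds (lamBar k)) →
      Filter.Tendsto (fun j => |P' k (xs j)|) Filter.atTop Filter.atTop)
    (hfeas : ∃ lam : Fin m → ℝ, B.mulVec lam = -b ∧ ∀ k, |lam k| < lamBar k) :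
    ∃! lamstar : Fin m → ℝ,
      (B.mulVec lamstar = -b ∧ ∀ k, |lamstar k| < lamBar k) ∧
      ∀ μ : Fin m → ℝ, B.mulVec μ = -b → (∀ k, |μ k| < lamBar k) →
        ∑ k, P k (lamstar k) ≤ ∑ k, P k (μ k) := by
  obtain ⟨a, haB, ha⟩ := hfeas
  have hmono (k : Fin m) : MonotoneOn (P' k) (Set.Ioo (-(lamBar k)) (lamBar k)) := by
    have h := (hconv k).convexOn.monotoneOn_deriv fun x hx => (hderiv k x hx).differentiableAt
    exact h.congr fun x hx => (hderiv k x hx).deriv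
  set f : (Fin m → ℝ) → ℝ := fun x => ∑ k, P k (x k)
  set A : Set (Fin m → ℝ) := {x | B.mulVec x = -b}
  have hAconv : Convex ℝ A := (convex_singleton (-b)).linear_preimage B.mulVecLin
  have hAclosed : IsClosed A :=
    isClosed_eq (continuous_const.matrix_mulVec continuous_id) continuous_const
  set F : Set (Fin m → ℝ) := A ∩ {x | ∀ k, |x k| < lamBar k}
  have hFconv : Convex ℝ F := by
    refine hAconv.inter ?_
    have : {x : Fin m → ℝ | ∀ k, |x k| < lamBar k} =
        Set.univ.pi fun k => Set.Ioo (-(lamBar k)) (lamBar k) := by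
      ext x
      simp [abs_lt]
    rw [this]
    exact convex_pi fun k _ => convex_Ioo _ _
  have hstrict : StrictConvexOn ℝ F f :=
    strictConvexOn_sum_apply hFconv (fun x hx k => abs_lt.1 (hx.2 k)) hconv
  have hfderiv (x : Fin m → ℝ) (hx : ∀ k, |x k| < lamBar k) :
      HasFDerivAt f (∑ k, P' k (x k) • ContinuousLinearMap.proj (R := ℝ) (φ := fun _ => ℝ) k) x :=
    HasFDerivAt.fun_sum fun k _ =>
      (hderiv k (x k) (abs_lt.1 (hx k))).comp_hasFDerivAt x (hasFDerivAt_apply k x)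
  set C : Fin m → ℝ := fun k => |P' k (a k)| * (2 * lamBar k)
  have hC0 (k : Fin m) : 0 ≤ C k := mul_nonneg (abs_nonneg _) (by linarith [hcap k])
  have hbound (k : Fin m) (x : ℝ) (hx : |x| < lamBar k) : P' k x * (a k - x) ≤ C k := by
    have h₁ : P' k x * (a k - x) ≤ P' k (a k) * (a k - x) := by
      rcases le_total (a k) x with h | h
      · exact mul_le_mul_of_nonpos_right
          (hmono k (abs_lt.1 (ha k)) (abs_lt.1 hx) h) (sub_nonpos.2 h)
      · exact mul_le_mul_of_nonneg_right
          (hmono k (abs_lt.1 hx) (abs_lt.1 (ha k)) h) (sub_nonneg.2 h)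
    have h₂ : |a k - x| ≤ 2 * lamBar k := by linarith [abs_sub (a k) x, ha k]
    calc P' k x * (a k - x) ≤ |P' k (a k) * (a k - x)| := h₁.trans (le_abs_self _)
      _ = |P' k (a k)| * |a k - x| := abs_mul _ _
      _ ≤ C k := mul_le_mul_of_nonneg_left h₂ (abs_nonneg _)
  choose r hr hrlt using fun k =>
    exists_radius_mul_sub_lt (hmono k) (hblow k) (ha k) (∑ i, C i)
  choose R hRgt hRlt using fun k => exists_between (max_lt (hr k) (ha k))
  set K : Set (Fin m → ℝ) := A ∩ Set.univ.pi fun k => Set.Icc (-R k) (R k) with hK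
  have hKmem (x : Fin m → ℝ) : x ∈ K ↔ x ∈ A ∧ ∀ k, |x k| ≤ R k := by
    simp only [hK, Set.mem_inter_iff, Set.mem_univ_pi, Set.mem_Icc, abs_le]
  have hKcompact : IsCompact K := (isCompact_univ_pi fun k => isCompact_Icc).inter_left hAclosed
  have hKconv : Convex ℝ K := hAconv.inter (convex_pi fun k _ => convex_Icc _ _)
  have hKF (x : Fin m → ℝ) (hx : x ∈ K) (k : Fin m) : |x k| < lamBar k :=
    (((hKmem x).1 hx).2 k).trans_lt (hRlt k)
  have haK : a ∈ K := (hKmem a).2 ⟨haB, fun k => ((le_max_right _ _).trans_lt (hRgt k)).le⟩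
  obtain ⟨x, hxK, hxmin⟩ := hKcompact.exists_isMinOn ⟨a, haK⟩ fun y hy =>
    (hfderiv y (hKF y hy)).continuousAt.continuousWithinAt
  have hvar : 0 ≤ ∑ k, P' k (x k) * (a k - x k) := by
    have h := hxmin.localize.hasFDerivWithinAt_nonneg
      (hfderiv x (hKF x hxK)).hasFDerivWithinAt
      (sub_mem_posTangentConeAt_of_segment_subset (hKconv.segment_subset hxK haK))
    simpa using h
  have hxr (k : Fin m) : |x k| < R k := by
    refine lt_of_lt_of_le ?_ ((le_max_left _ _).trans_lt (hRgt k)).le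
    by_contra! hk
    have hlt := hrlt k (x k) (abs_lt.1 (hKF x hxK k)) hk
    have hle := Finset.sum_le_sum fun i (_ : i ∈ Finset.univ.erase k) =>
      hbound i (x i) (hKF x hxK i)
    rw [← Finset.add_sum_erase _ _ (Finset.mem_univ k)] at hvar hlt
    linarith [hC0 k]
  have hxF : x ∈ F := ⟨hxK.1, hKF x hxK⟩
  have hloc : IsLocalMinOn f F x := by
    have hev : ∀ᶠ y in nhds x, ∀ k, |y k| < R k := Filter.eventually_all.2 fun k =>
      (continuous_apply k).abs.continuousAt.eventually_lt_const (hxr k)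
    filter_upwards [nhdsWithin_le_nhds hev, self_mem_nhdsWithin] with y hy hyF
    exact hxmin ((hKmem y).2 ⟨hyF.1, fun k => (hy k).le⟩)
  have hglob : IsMinOn f F x := IsMinOn.of_isLocalMinOn_of_convexOn hxF hloc hstrict.convexOn
  refine ⟨x, ⟨hxF, fun μ hμ hμ' => hglob ⟨hμ, hμ'⟩⟩, fun y hy => ?_⟩
  exact hstrict.eq_of_isMinOn (fun μ hμ => hy.2 μ hμ.1 hμ.2) hglob hy.1 hxF
end

section
/- Spanning-tree solution of the generalized Dirichlet problem (Biggs): Let 𝒢 be a finite connected oriented graph with incidence matrix B ∈ ℝ^{n×m}, let h_k > 0 for each edge k and H = diag(h_1,…,h_m). For a spanning tree T (an edge set of size n−1 whose edges form a spanning tree of 𝒢) let h(T) = Π_{k∈T} h_k, and let h̄ = Σ_T h(T) (sum over all spanning trees); then h̄ > 0. For an edge k ∈ T, let U(T,k) be the node set of the connected component of T with edge k removed that contains the positive end of k (the node i with B_{ik} = +1). Define X ∈ ℝ^{m×n} by X_{ki} = (1/h̄) · Σ { h(T) : T a spanning tree with k ∈ T and i ∈ U(T,k) }. Then for every v ∈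 ℝ^m, the vector z = Xᵀ H^{−1} v satisfies (B H Bᵀ) z = B v; equivalently, B H Bᵀ Xᵀ = B H. -/
open Matrix

namespace OrientedMultigraph

variable {V κ : Type*} {src dst : κ → V} {F T : Finset κ} {a b c : V} {e k : κ}

/-- `b` can be reached from `a` along edges of `F`, traversed in either direction. -/
def Reach (src dst : κ → V) (F : Finset κ) : V → V → Prop :=
  Relation.ReflTransGen
    (fun a b => ∃ k ∈ F, (src k = a ∧ dst k = b) ∨ (src k = b ∧ dst k = a))

theorem Reach.refl (a : V) : Reach src dst F a a := Relation.ReflTransGen.refl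

theorem Reach.trans (hab : Reach src dst F a b) (hbc : Reach src dst F b c) :
    Reach src dst F a c := Relation.ReflTransGen.trans hab hbc

theorem Reach.symm (hab : Reach src dst F a b) : Reach src dst F b a := by
  induction hab with
  | refl => exact Reach.refl a
  | tail _ hstep ih =>
    obtain ⟨k, hk, hor⟩ := hstep
    exact Relation.ReflTransGen.head ⟨k, hk, hor.symm⟩ ih

theorem Reach.mono (hFT : F ⊆ T) (hab : Reach src dst F a b) : Reach src dst T a b :=
  Relation.ReflTransGen.mono (fun _ _ ⟨k, hk, hor⟩ => ⟨k, hFT hk, hor⟩) a b hab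

theorem Reach.of_mem (hk : k ∈ F) : Reach src dst F (src k) (dst k) :=
  Relation.ReflTransGen.single ⟨k, hk, Or.inl ⟨rfl, rfl⟩⟩

theorem Reach.of_edges (hF : ∀ k ∈ F, Reach src dst T (src k) (dst k))
    (hab : Reach src dst F a b) : Reach src dst T a b := by
  induction hab with
  | refl => exact Reach.refl a
  | tail _ hstep ih =>
    obtain ⟨k, hk, ⟨rfl, rfl⟩ | ⟨rfl, rfl⟩⟩ := hstep
    · exact ih.trans (hF k hk)
    · exact ih.trans (hF k hk).symm

theorem Reach.insert_cases [DecidableEq κ] (hab : Reach src dst (insert k F) a b)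
    (ha : Reach src dst F (src k) a ∨ Reach src dst F (dst k) a) :
    Reach src dst F (src k) b ∨ Reach src dst F (dst k) b := by
  induction hab with
  | refl => exact ha
  | tail _ hstep ih =>
    obtain ⟨l, hl, hor⟩ := hstep
    rcases Finset.mem_insert.1 hl with rfl | hl
    · rcases hor with ⟨rfl, rfl⟩ | ⟨rfl, rfl⟩
      · exact Or.inr (Reach.refl _)
      · exact Or.inl (Reach.refl _)
    · exact ih.imp (fun h => h.trans (Relation.ReflTransGen.single ⟨l, hl, hor⟩))
        (fun h => h.trans (Relation.ReflTransGen.single ⟨l, hl, hor⟩))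

/-- The simple graph underlying a set of oriented edges. -/
def toSimpleGraph (src dst : κ → V) (F : Finset κ) : SimpleGraph V :=
  SimpleGraph.fromRel fun a b => ∃ k ∈ F, src k = a ∧ dst k = b

theorem Reach.reachable (hab : Reach src dst F a b) :
    (toSimpleGraph src dst F).Reachable a b := by
  induction hab with
  | refl => exact SimpleGraph.Reachable.refl _
  | @tail b c _ hstep ih =>
    refine ih.trans ?_
    by_cases hbc : b = c
    · exact hbc ▸ SimpleGraph.Reachable.refl _
    · refine SimpleGraph.Adj.reachable ((SimpleGraph.fromRel_adj _ _ _).2 ⟨hbc, ?_⟩)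
      obtain ⟨k, hk, hor | hor⟩ := hstep
      · exact Or.inl ⟨k, hk, hor⟩
      · exact Or.inr ⟨k, hk, hor⟩

theorem connected_toSimpleGraph [Nonempty V] (hF : ∀ a b, Reach src dst F a b) :
    (toSimpleGraph src dst F).Connected :=
  (SimpleGraph.connected_iff _).2 ⟨fun a b => (hF a b).reachable, inferInstance⟩

theorem exists_of_mem_edgeSet {p : Sym2 V} (hp : p ∈ (toSimpleGraph src dst F).edgeSet) :
    ∃ k ∈ F, s(src k, dst k) = p := by
  induction p using Sym2.ind with
  | _ a b =>
    obtain ⟨_, ⟨k, hk, rfl, rfl⟩ | ⟨k, hk, rfl, rfl⟩⟩ :=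
      (SimpleGraph.fromRel_adj _ _ _).1 ((SimpleGraph.mem_edgeSet _).1 hp)
    · exact ⟨k, hk, rfl⟩
    · exact ⟨k, hk, Sym2.eq_swap⟩

variable [Fintype V]

theorem card_le_card_add_one [Nonempty V] (hF : ∀ a b, Reach src dst F a b) :
    Fintype.card V ≤ F.card + 1 := by
  classical
  have hcard := (connected_toSimpleGraph hF).card_vert_le_card_edgeSet_add_one
  rw [Nat.card_eq_fintype_card] at hcard
  refine hcard.trans (Nat.add_le_add_right ?_ 1)
  have hsub : (toSimpleGraph src dst F).edgeSet ⊆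
      (F.image fun k => s(src k, dst k) : Finset (Sym2 V)) := by
    intro p hp
    simpa using exists_of_mem_edgeSet hp
  calc Nat.card (toSimpleGraph src dst F).edgeSet
      ≤ Nat.card ((F.image fun k => s(src k, dst k) : Finset (Sym2 V)) : Set (Sym2 V)) :=
        Nat.card_mono (Finset.finite_toSet _) hsub
    _ = (F.image fun k => s(src k, dst k)).card := by simp
    _ ≤ F.card := Finset.card_image_le

/-- `T` is the edge set of a spanning tree. -/
def IsSpanningTree (src dst : κ → V) (T : Finset κ) : Prop :=
  T.card + 1 = Fintype.card V ∧ ∀ a b, Reach src dst T a b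

theorem exists_isSpanningTree [Nonempty V] (hF : ∀ a b, Reach src dst F a b) :
    ∃ T, IsSpanningTree src dst T := by
  classical
  obtain ⟨G, hGle, hG⟩ := (connected_toSimpleGraph hF).exists_isTree_le
  have hedge : ∀ p : G.edgeSet, ∃ k, s(src k, dst k) = p.1 := fun p =>
    let ⟨k, _, hk⟩ := exists_of_mem_edgeSet (SimpleGraph.edgeSet_mono hGle p.2)
    ⟨k, hk⟩
  choose f hf using hedge
  have hinj : Function.Injective f := fun p q hpq => Subtype.ext (by rw [← hf, ← hf, hpq])
  refine ⟨Finset.univ.image f, ?_, fun a b => ?_⟩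
  · rw [Finset.card_image_of_injective _ hinj, Finset.card_univ, ← hG.card_edgeFinset,
      SimpleGraph.edgeFinset_card]
  · obtain ⟨w⟩ := hG.connected.preconnected a b
    induction w with
    | nil => exact Reach.refl _
    | @cons a b _ hadj _ ih =>
      refine Reach.trans (Relation.ReflTransGen.single
        ⟨f ⟨s(a, b), hadj⟩, by simp, ?_⟩) ih
      have := hf ⟨s(a, b), hadj⟩
      simpa [Sym2.eq_iff] using this

theorem IsSpanningTree.not_reach [DecidableEq κ] (hk : k ∉ F)
    (hT : IsSpanningTree src dst (insert k F)) : ¬ Reach src dst F (src k) (dst k) := by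
  intro hreach
  have : Nonempty V := ⟨src k⟩
  have hle := card_le_card_add_one (src := src) (dst := dst) (F := F) fun a b =>
    (hT.2 a b).of_edges fun l hl => by
      rcases Finset.mem_insert.1 hl with rfl | hl
      · exact hreach
      · exact Reach.of_mem hl
  have hcard := hT.1
  rw [Finset.card_insert_of_notMem hk] at hcard
  omega

theorem IsSpanningTree.reach_or [DecidableEq κ] (hT : IsSpanningTree src dst (insert k F))
    (a : V) : Reach src dst F (src k) a ∨ Reach src dst F (dst k) a :=
  (hT.2 (src k) a).insert_cases (Or.inl (Reach.refl _))

open Classical in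
/-- The sign with which the edge `e` leaves the component of `a` in `F`. -/
noncomputable def crossing (src dst : κ → V) (F : Finset κ) (a : V) (e : κ) : ℝ :=
  (if Reach src dst F a (src e) then 1 else 0) - (if Reach src dst F a (dst e) then 1 else 0)

theorem IsSpanningTree.exchange [DecidableEq κ] (hk : k ∉ F)
    (hT : IsSpanningTree src dst (insert k F)) (he : crossing src dst F (src k) e ≠ 0) :
    e ∉ F ∧ IsSpanningTree src dst (insert e F) ∧
      crossing src dst F (src e) k = crossing src dst F (src k) e := by
  have hnot := hT.not_reach hk
  have heF : e ∉ F := by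
    intro heF
    have hiff : Reach src dst F (src k) (src e) ↔ Reach src dst F (src k) (dst e) :=
      ⟨fun h => h.trans (Reach.of_mem heF), fun h => h.trans (Reach.of_mem heF).symm⟩
    refine he ?_
    by_cases h : Reach src dst F (src k) (dst e) <;> simp [crossing, hiff, h]
  have hsub : F ⊆ insert e F := Finset.subset_insert _ _
  have hemem : Reach src dst (insert e F) (src e) (dst e) :=
    Reach.of_mem (Finset.mem_insert_self _ _)
  have key : Reach src dst (insert e F) (src k) (dst k) ∧
      crossing src dst F (src e) k = crossing src dst F (src k) e := by
    by_cases h1 : Reach src dst F (src k) (src e) <;>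
      by_cases h2 : Reach src dst F (src k) (dst e)
    · simp [crossing, h1, h2] at he
    · have h3 := (hT.reach_or (dst e)).resolve_left h2
      have h4 : ¬ Reach src dst F (src e) (dst k) := fun h => hnot (h1.trans h)
      exact ⟨((h1.mono hsub).trans hemem).trans (h3.mono hsub).symm,
        by simp [crossing, h1, h2, h1.symm, h4]⟩
    · have h3 := (hT.reach_or (src e)).resolve_left h1
      have h4 : ¬ Reach src dst F (src e) (src k) := fun h => h1 h.symm
      exact ⟨((h2.mono hsub).trans hemem.symm).trans (h3.mono hsub).symm,
        by simp [crossing, h1, h2, h3.symm, h4]⟩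
    · simp [crossing, h1, h2] at he
  refine ⟨heF, ⟨?_, fun a b => (hT.2 a b).of_edges fun l hl => ?_⟩, key.2⟩
  · rw [← hT.1, Finset.card_insert_of_notMem hk, Finset.card_insert_of_notMem heF]
  · rcases Finset.mem_insert.1 hl with rfl | hl
    · exact key.1
    · exact Reach.of_mem (hsub hl)

open Classical in
theorem crossing_exchange [DecidableEq κ] (src dst : κ → V) (F : Finset κ) (k e : κ) :
    (if k ∉ F ∧ IsSpanningTree src dst (insert k F) then crossing src dst F (src k) e else 0) =
      if e ∉ F ∧ IsSpanningTree src dst (insert e F) then crossing src dst F (src e) k else 0 := by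
  split_ifs with hk he he
  · by_cases hne : crossing src dst F (src k) e = 0
    · by_contra h
      exact h (he.2.exchange he.1 fun h0 => h (hne.trans h0.symm)).2.2
    · exact (hk.2.exchange hk.1 hne).2.2.symm
  · by_contra hne
    exact he ⟨(hk.2.exchange hk.1 hne).1, (hk.2.exchange hk.1 hne).2.1⟩
  · by_contra hne
    have := he.2.exchange he.1 (Ne.symm hne)
    exact hk ⟨this.1, this.2.1⟩
  · rfl

open Classical in
theorem sum_erase_mul_prod [Fintype κ] [DecidableEq κ] (P : Finset κ → Prop)
    (g : Finset κ → ℝ) (h : κ → ℝ) (k : κ) :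
    ∑ T with P T ∧ k ∈ T, g (T.erase k) * ∏ l ∈ T, h l =
      h k * ∑ F, (if k ∉ F ∧ P (insert k F) then g F else 0) * ∏ l ∈ F, h l := by
  simp only [ite_mul, zero_mul]
  rw [← Finset.sum_filter, Finset.mul_sum]
  refine Finset.sum_bij' (fun T _ => T.erase k) (fun F _ => insert k F) ?_ ?_ ?_ ?_ ?_
  · intro T hT
    simp only [Finset.mem_filter, Finset.mem_univ, true_and] at hT ⊢
    simpa [Finset.insert_erase hT.2] using hT.1
  · intro F hF
    simp only [Finset.mem_filter, Finset.mem_univ, true_and] at hF ⊢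
    exact ⟨hF.2, Finset.mem_insert_self _ _⟩
  · intro T hT
    simp only [Finset.mem_filter, Finset.mem_univ, true_and] at hT
    exact Finset.insert_erase hT.2
  · intro F hF
    simp only [Finset.mem_filter, Finset.mem_univ, true_and] at hF
    exact Finset.erase_insert hF.1
  · intro T hT
    simp only [Finset.mem_filter, Finset.mem_univ, true_and] at hT
    rw [← Finset.mul_prod_erase T h hT.2]
    ring

open Classical in
/-- The entry of the incidence matrix at the node `i` and the edge `k`. -/
noncomputable def incidence (src dst : κ → V) (i : V) (k : κ) : ℝ :=
  (if i = src k then 1 else 0) - (if i = dst k then 1 else 0)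

open Classical in
theorem IsSpanningTree.sum_incidence_mul_crossing [DecidableEq κ]
    (hT : IsSpanningTree src dst T) (i : V) (k : κ) :
    ∑ e ∈ T, incidence src dst i e * crossing src dst (T.erase e) (src e) k =
      incidence src dst i k := by
  let f : V → ℝ := fun a => ∑ e ∈ T, incidence src dst i e *
    (if Reach src dst (T.erase e) (src e) a then 1 else 0)
  have hedge : ∀ e ∈ T, f (src e) - f (dst e) = incidence src dst i e := by
    intro e he
    have hsub : f (src e) - f (dst e) =
        ∑ l ∈ T, incidence src dst i l * crossing src dst (T.erase l) (src l) e := by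
      simp only [f, crossing, mul_sub, Finset.sum_sub_distrib]
    rw [hsub, Finset.sum_eq_single e]
    · have hnot : ¬ Reach src dst (T.erase e) (src e) (dst e) :=
        IsSpanningTree.not_reach (Finset.notMem_erase e T) (by rwa [Finset.insert_erase he])
      simp [crossing, hnot, Reach.refl]
    · intro l _ hle
      have hmem : e ∈ T.erase l := Finset.mem_erase.2 ⟨hle.symm, he⟩
      have hiff : Reach src dst (T.erase l) (src l) (src e) ↔
          Reach src dst (T.erase l) (src l) (dst e) :=
        ⟨fun h => h.trans (Reach.of_mem hmem), fun h => h.trans (Reach.of_mem hmem).symm⟩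
      simp [crossing, hiff]
    · exact fun h => absurd he h
  have hpath : ∀ a b, Reach src dst T a b →
      f a - f b = (if i = a then 1 else 0) - (if i = b then 1 else 0) := by
    intro a b hab
    induction hab with
    | refl => simp
    | tail _ hstep ih =>
      obtain ⟨e, he, ⟨rfl, rfl⟩ | ⟨rfl, rfl⟩⟩ := hstep <;>
      · have := hedge e he
        unfold incidence at this
        linarith
  have := hpath _ _ (hT.2 (src k) (dst k))
  simpa only [f, crossing, incidence, mul_sub, Finset.sum_sub_distrib] using this

open Classical in
theorem sum_incidence_mul_sum_crossing [Fintype κ] [DecidableEq κ] (src dst : κ → V)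
    (h : κ → ℝ) (i : V) (k : κ) :
    ∑ e, incidence src dst i e * h e *
        ∑ T with IsSpanningTree src dst T ∧ k ∈ T,
          crossing src dst (T.erase k) (src k) e * ∏ l ∈ T, h l =
      incidence src dst i k * h k * ∑ T with IsSpanningTree src dst T, ∏ l ∈ T, h l := by
  calc
    _ = ∑ e, incidence src dst i e * h k *
        ∑ T with IsSpanningTree src dst T ∧ e ∈ T,
          crossing src dst (T.erase e) (src e) k * ∏ l ∈ T, h l := by
      refine Finset.sum_congr rfl fun e _ => ?_
      rw [sum_erase_mul_prod _ (fun F => crossing src dst F (src k) e),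
        sum_erase_mul_prod _ (fun F => crossing src dst F (src e) k)]
      simp only [crossing_exchange src dst _ k e]
      ring
    _ = h k * ∑ T with IsSpanningTree src dst T,
        (∑ e ∈ T, incidence src dst i e * crossing src dst (T.erase e) (src e) k) *
          ∏ l ∈ T, h l := by
      simp only [Finset.mul_sum, Finset.sum_mul]
      rw [Finset.sum_comm' (t' := Finset.univ.filter fun T => IsSpanningTree src dst T)
        (s' := fun T => T) (by simp [and_comm])]
      refine Finset.sum_congr rfl fun T _ => Finset.sum_congr rfl fun e _ => ?_
      ring
    _ = _ := by
      rw [Finset.sum_congr rfl fun T hT => by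
        rw [(Finset.mem_filter.1 hT).2.sum_incidence_mul_crossing i k], ← Finset.mul_sum]
      ring

end OrientedMultigraph

open OrientedMultigraph
open Classical in
/-- Spanning-tree solution of the generalized Dirichlet problem (Biggs). -/
theorem generalized_dirichlet_spanning_tree_solution {n m : ℕ} (hn : 0 < n)
    (src dst : Fin m → Fin n) (hloop : ∀ k, src k ≠ dst k)
    (hconn : ∀ i j : Fin n, Relation.ReflTransGen
      (fun a b => ∃ k, (src k = a ∧ dst k = b) ∨ (src k = b ∧ dst k = a)) i j)
    (B : Matrix (Fin n) (Fin m) ℝ)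
    (hB : B = Matrix.of fun i k => if i = src k then (1 : ℝ) else if i = dst k then -1 else 0)
    (h : Fin m → ℝ) (hpos : ∀ k, 0 < h k)
    (H : Matrix (Fin m) (Fin m) ℝ) (hH : H = Matrix.diagonal h)
    (SpTree : Finset (Fin m) → Prop)
    (hSpTree : ∀ T : Finset (Fin m), SpTree T ↔
      (T.card + 1 = n ∧ ∀ i j : Fin n, Relation.ReflTransGen
        (fun a b => ∃ k ∈ T, (src k = a ∧ dst k = b) ∨ (src k = b ∧ dst k = a)) i j))
    (hbar : ℝ)
    (hhbar : hbar = ∑ T ∈ Finset.univ.filter (fun T => SpTree T), ∏ k ∈ T, h k)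
    (X : Matrix (Fin m) (Fin n) ℝ)
    (hX : ∀ k i, X k i =
      (∑ T ∈ Finset.univ.filter (fun T : Finset (Fin m) => SpTree T ∧ k ∈ T ∧
          Relation.ReflTransGen
            (fun a b => ∃ l ∈ T.erase k, (src l = a ∧ dst l = b) ∨ (src l = b ∧ dst l = a))
            (src k) i),
        ∏ l ∈ T, h l) / hbar) :
    0 < hbar ∧
    (∀ v : Fin m → ℝ,
      (B * H * Bᵀ).mulVec (Xᵀ.mulVec ((Matrix.diagonal fun k => (h k)⁻¹).mulVec v)) =
        B.mulVec v) ∧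
    B * H * Bᵀ * Xᵀ = B * H := by
  classical
  have : Nonempty (Fin n) := ⟨⟨0, hn⟩⟩
  have hTree : ∀ T, SpTree T ↔ IsSpanningTree src dst T := fun T => by
    rw [hSpTree, IsSpanningTree, Fintype.card_fin]; rfl
  have hBinc : ∀ i k, B i k = incidence src dst i k := by
    intro i k
    have hk := hloop k
    simp only [hB, Matrix.of_apply, incidence]
    split_ifs with hs hd
    · exact absurd (hs.symm.trans hd) hk
    all_goals simp
  have hbar_pos : 0 < hbar := by
    rw [hhbar]
    refine Finset.sum_pos (fun T _ => Finset.prod_pos fun k _ => hpos k) ?_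
    obtain ⟨T, hT⟩ := exists_isSpanningTree (src := src) (dst := dst) (F := Finset.univ)
      fun i j => Relation.ReflTransGen.mono
        (fun a b ⟨k, hk⟩ => ⟨k, Finset.mem_univ k, hk⟩) i j (hconn i j)
    exact ⟨T, by simpa [hTree] using hT⟩
  have hdiff : ∀ e k, ∑ j, B j e * X k j =
      (∑ T with IsSpanningTree src dst T ∧ k ∈ T,
        crossing src dst (T.erase k) (src k) e * ∏ l ∈ T, h l) / hbar := by
    intro e k
    have hXk : ∀ j, X k j = (∑ T with IsSpanningTree src dst T ∧ k ∈ T,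
        (if Reach src dst (T.erase k) (src k) j then 1 else 0) * ∏ l ∈ T, h l) / hbar := by
      intro j
      simp only [hX, hTree, ite_mul, one_mul, zero_mul]
      rw [← Finset.sum_filter, Finset.filter_filter]
      simp only [and_assoc]
      rfl
    have hsum : ∑ j, B j e * X k j = X k (src e) - X k (dst e) := by
      simp [hBinc, incidence, sub_mul, Finset.sum_sub_distrib]
    rw [hsum, hXk, hXk, ← sub_div, ← Finset.sum_sub_distrib]
    simp only [crossing, sub_mul]
  have hmat : B * H * Bᵀ * Xᵀ = B * H := by
    ext i k
    have hBX : ∀ e, (Bᵀ * Xᵀ) e k = ∑ j, B j e * X k j := fun e => rfl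
    rw [Matrix.mul_assoc, hH, Matrix.mul_apply]
    simp only [Matrix.mul_diagonal, hBX, hdiff]
    simp only [← mul_div_assoc, ← Finset.sum_div, hBinc]
    rw [sum_incidence_mul_sum_crossing, div_eq_iff hbar_pos.ne', hhbar]
    simp only [hTree]
  refine ⟨hbar_pos, fun v => ?_, hmat⟩
  rw [Matrix.mulVec_mulVec, hmat, Matrix.mulVec_mulVec, Matrix.mul_assoc, hH,
    Matrix.diagonal_mul_diagonal]
  simp [fun k => mul_inv_cancel₀ (hpos k).ne']
end

section
/- Injectivity of the dual-to-divergence map: Let 𝒢 be a finite connected oriented graph with incidence matrix B ∈ ℝ^{n×m}, and for each edge k let g_k : ℝ → ℝ be strictly increasing; write g : ℝ^m → ℝ^m for the componentwise map. If ζ₁, ζ₂ ∈ ℝ^n satisfy B g(Bᵀζ₁) = B g(Bᵀζ₂) and 1_nᵀ ζ₁ = 1_nᵀ ζ₂, then ζ₁ = ζ₂. -/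
open Matrix

/-- Vectors with the same image under `x ↦ B g(Bᵀ x)`, where `g` acts componentwise by strictly
increasing functions, have the same image under `Bᵀ`. -/
theorem transpose_mulVec_eq_of_mulVec_strictMono_eq {ι κ : Type*} [Fintype ι] [Fintype κ]
    (B : Matrix ι κ ℝ) {g : κ → ℝ → ℝ} (hg : ∀ k, StrictMono (g k)) {x y : ι → ℝ}
    (h : B *ᵥ (fun k => g k ((Bᵀ *ᵥ x) k)) = B *ᵥ (fun k => g k ((Bᵀ *ᵥ y) k))) :
    Bᵀ *ᵥ x = Bᵀ *ᵥ y := by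
  have hzero : ∑ k, ((Bᵀ *ᵥ x) k - (Bᵀ *ᵥ y) k) *
      (g k ((Bᵀ *ᵥ x) k) - g k ((Bᵀ *ᵥ y) k)) = 0 := by
    change (Bᵀ *ᵥ x - Bᵀ *ᵥ y) ⬝ᵥ
      ((fun k => g k ((Bᵀ *ᵥ x) k)) - fun k => g k ((Bᵀ *ᵥ y) k)) = 0
    rw [← mulVec_sub, mulVec_transpose, ← dotProduct_mulVec, mulVec_sub, h, sub_self,
      dotProduct_zero]
  have hnonneg : ∀ k ∈ Finset.univ, 0 ≤ ((Bᵀ *ᵥ x) k - (Bᵀ *ᵥ y) k) *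
      (g k ((Bᵀ *ᵥ x) k) - g k ((Bᵀ *ᵥ y) k)) := fun k _ => by
    rcases le_total ((Bᵀ *ᵥ x) k) ((Bᵀ *ᵥ y) k) with hk | hk
    · exact mul_nonneg_of_nonpos_of_nonpos (sub_nonpos.2 hk)
        (sub_nonpos.2 ((hg k).monotone hk))
    · exact mul_nonneg (sub_nonneg.2 hk) (sub_nonneg.2 ((hg k).monotone hk))
  ext k
  rcases mul_eq_zero.1 ((Finset.sum_eq_zero_iff_of_nonneg hnonneg).1 hzero k
    (Finset.mem_univ k)) with hk | hk
  · exact sub_eq_zero.1 hk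
  · exact (hg k).injective (sub_eq_zero.1 hk)

/-- The transposed incidence matrix of a loopless oriented graph takes differences along edges. -/
theorem incidence_transpose_mulVec {ι κ : Type*} [Fintype ι] [DecidableEq ι]
    {src dst : κ → ι} (hloop : ∀ k, src k ≠ dst k) (x : ι → ℝ) (k : κ) :
    ((Matrix.of fun i k => if i = src k then (1 : ℝ) else if i = dst k then -1 else 0)ᵀ *ᵥ x) k =
      x (src k) - x (dst k) := by
  have hsplit : ∀ i, (if i = src k then (1 : ℝ) else if i = dst k then -1 else 0) * x i =
      (if i = src k then x i else 0) - (if i = dst k then x i else 0) := fun i => by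
    have := hloop k
    split_ifs <;> grind
  simp [mulVec, dotProduct, hsplit, Finset.sum_sub_distrib]

/-- Injectivity of the dual-to-divergence map. -/
theorem dual_to_divergence_injective {n m : ℕ}
    (src dst : Fin m → Fin n) (hloop : ∀ k, src k ≠ dst k)
    (hconn : ∀ i j : Fin n, Relation.ReflTransGen
      (fun a b => ∃ k, (src k = a ∧ dst k = b) ∨ (src k = b ∧ dst k = a)) i j)
    (B : Matrix (Fin n) (Fin m) ℝ)
    (hB : B = Matrix.of fun i k => if i = src k then (1 : ℝ) else if i = dst k then -1 else 0)
    (g : Fin m → ℝ → ℝ) (hg : ∀ k, StrictMono (g k))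
    (ζ₁ ζ₂ : Fin n → ℝ)
    (hdiv : B.mulVec (fun k => g k (Bᵀ.mulVec ζ₁ k)) =
            B.mulVec (fun k => g k (Bᵀ.mulVec ζ₂ k)))
    (hsum : ∑ i, ζ₁ i = ∑ i, ζ₂ i) :
    ζ₁ = ζ₂ := by
  have hedge (k : Fin m) : ζ₁ (src k) - ζ₁ (dst k) = ζ₂ (src k) - ζ₂ (dst k) := by
    have hk := congrFun (transpose_mulVec_eq_of_mulVec_strictMono_eq B hg hdiv) k
    rwa [hB, incidence_transpose_mulVec hloop, incidence_transpose_mulVec hloop] at hk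
  have hconst (i j : Fin n) : ζ₁ i - ζ₂ i = ζ₁ j - ζ₂ j := by
    induction hconn i j with
    | refl => rfl
    | tail _ hstep ih =>
      obtain ⟨k, ⟨rfl, rfl⟩ | ⟨rfl, rfl⟩⟩ := hstep <;> linarith [hedge k]
  ext i
  have htotal : ∑ j, (ζ₁ j - ζ₂ j) = 0 := by
    rw [Finset.sum_sub_distrib, hsum, sub_self]
  rw [Finset.sum_congr rfl fun j _ => hconst j i, Finset.sum_const, Finset.card_univ,
    Fintype.card_fin, nsmul_eq_mul] at htotal
  have hn : (n : ℝ) ≠ 0 := Nat.cast_ne_zero.2 i.pos.ne'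
  exact sub_eq_zero.1 ((mul_eq_zero.1 htotal).resolve_left hn)
end

section
/- Feed-forward optimality along trajectories (Proposition 2, reduced form): Let B ∈ ℝ^{n×m}, capacities λ̄_k ∈ (0,∞), and for each k let 𝒫_k : (−λ̄_k, λ̄_k) → ℝ be strictly convex and differentiable with |𝒫_k'| blowing up at the boundary, so that p_k := 𝒫_k' is a strictly increasing bijection onto ℝ; assume moreover that each inverse g_k := p_k^{−1} : ℝ → ℝ is differentiable, and write g for the componentwise map and Dg(z) = diag(g_1'(z_1),…,g_m'(z_m)). Let ζ, d : [0,∞) → ℝ^n be differentiable with 1_nᵀ d(t) = 0 for all t, satisfying B · Dg(Bᵀζ(t)) · Bᵀ ζ̇(t) + ḋ(t) = 0 for all t ≥ 0 and B g(Bᵀζ(0)) + d(0) = 0. Then for every t ≥ 0, the flow λ(t) := g(Bᵀζ(t)) is the unique minimizer of Σ_{k=1}^m 𝒫_k(λ_k) over { λ ∈ ℝ^m : Bλ = −d(t) and |λ_k| < λ̄_k for all k }. -/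
open Matrix

theorem StrictConvexOn.tangent_lt {S : Set ℝ} {f : ℝ → ℝ} {f' x y : ℝ}
    (hf : StrictConvexOn ℝ S f) (hx : x ∈ S) (hy : y ∈ S) (hxy : y ≠ x)
    (hd : HasDerivAt f f' x) : f x + f' * (y - x) < f y := by
  rcases lt_or_gt_of_ne hxy with h | h
  · have h₁ := hf.slope_lt_of_hasDerivAt hy hx h hd
    rw [slope_def_field, div_lt_iff₀ (sub_pos.2 h)] at h₁
    linarith
  · have h₁ := hf.lt_slope_of_hasDerivAt hx hy h hd
    rw [slope_def_field, lt_div_iff₀ (sub_pos.2 h)] at h₁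
    linarith

theorem HasDerivAt.matrix_mulVec {m n : Type*} [Fintype m] [Fintype n] (A : Matrix m n ℝ)
    {v : ℝ → n → ℝ} {v' : n → ℝ} {t : ℝ} (hv : HasDerivAt v v' t) :
    HasDerivAt (fun s => A.mulVec (v s)) (A.mulVec v') t :=
  (Matrix.mulVecLin A).toContinuousLinearMap.hasFDerivAt.comp_hasDerivAt t hv

/-- Feed-forward optimality along trajectories (Proposition 2, reduced form). -/
theorem feedforward_optimality_along_trajectories {n m : ℕ}
    (B : Matrix (Fin n) (Fin m) ℝ)
    (lamBar : Fin m → ℝ) (hcap : ∀ k, 0 < lamBar k)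
    (P p : Fin m → ℝ → ℝ)
    (hconv : ∀ k, StrictConvexOn ℝ (Set.Ioo (-(lamBar k)) (lamBar k)) (P k))
    (hderiv : ∀ k, ∀ y ∈ Set.Ioo (-(lamBar k)) (lamBar k), HasDerivAt (P k) (p k y) y)
    (hblow : ∀ k, ∀ xs : ℕ → ℝ, (∀ j, xs j ∈ Set.Ioo (-(lamBar k)) (lamBar k)) →
      Filter.Tendsto (fun j => |xs j|) Filter.atTop (nhds (lamBar k)) →
      Filter.Tendsto (fun j => |p k (xs j)|) Filter.atTop Filter.atTop)
    (g g' : Fin m → ℝ → ℝ)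
    (hg_mem : ∀ k y, g k y ∈ Set.Ioo (-(lamBar k)) (lamBar k))
    (hg_right : ∀ k y, p k (g k y) = y)
    (hg_left : ∀ k, ∀ y ∈ Set.Ioo (-(lamBar k)) (lamBar k), g k (p k y) = y)
    (hg_deriv : ∀ k y, HasDerivAt (g k) (g' k y) y)
    (ζ d ζ' d' : ℝ → Fin n → ℝ)
    (hζ : ∀ t ≥ (0 : ℝ), HasDerivAt ζ (ζ' t) t)
    (hd : ∀ t ≥ (0 : ℝ), HasDerivAt d (d' t) t)
    (hbal : ∀ t ≥ (0 : ℝ), ∑ i, d t i = 0)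
    (hode : ∀ t ≥ (0 : ℝ),
      B.mulVec (fun k => g' k (Bᵀ.mulVec (ζ t) k) * Bᵀ.mulVec (ζ' t) k) + d' t = 0)
    (hinit : B.mulVec (fun k => g k (Bᵀ.mulVec (ζ 0) k)) + d 0 = 0)
    (lam : ℝ → Fin m → ℝ) (hlam : ∀ t, lam t = fun k => g k (Bᵀ.mulVec (ζ t) k)) :
    ∀ t ≥ (0 : ℝ),
      (B.mulVec (lam t) = -(d t) ∧ ∀ k, |lam t k| < lamBar k) ∧
      ∀ μ : Fin m → ℝ, B.mulVec μ = -(d t) → (∀ k, |μ k| < lamBar k) → μ ≠ lam t →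
        ∑ k, P k (lam t k) < ∑ k, P k (μ k) := by
  intro t ht
  have hfeas : B.mulVec (lam t) + d t = 0 := by
    have hderiv_zero : ∀ s ≥ (0 : ℝ), HasDerivAt (fun s => B.mulVec (lam s) + d s) 0 s := by
      intro s hs
      rw [← hode s hs, funext hlam]
      refine (HasDerivAt.matrix_mulVec B (hasDerivAt_pi.2 fun k => ?_)).add (hd s hs)
      exact (hg_deriv k _).comp s (hasDerivAt_pi.1 ((hζ s hs).matrix_mulVec Bᵀ) k)
    have hconst := constant_of_has_deriv_right_zero
      (fun s hs => (hderiv_zero s hs.1).continuousAt.continuousWithinAt)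
      (fun s hs => (hderiv_zero s hs.1).hasDerivWithinAt) t ⟨ht, le_rfl⟩
    rw [hconst, hlam, hinit]
  have hmem : ∀ k, lam t k ∈ Set.Ioo (-(lamBar k)) (lamBar k) := fun k => by
    rw [hlam]
    exact hg_mem k _
  refine ⟨⟨eq_neg_of_add_eq_zero_left hfeas, fun k => abs_lt.2 (hmem k)⟩, ?_⟩
  intro μ hμ hμ_cap hne
  have hp : ∀ k, p k (lam t k) = Bᵀ.mulVec (ζ t) k := fun k => by
    rw [hlam]
    exact hg_right k _
  have htangent : ∀ k, μ k ≠ lam t k →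
      P k (lam t k) + Bᵀ.mulVec (ζ t) k * (μ k - lam t k) < P k (μ k) := fun k hk =>
    hp k ▸ (hconv k).tangent_lt (hmem k) (abs_lt.1 (hμ_cap k)) hk (hderiv k _ (hmem k))
  have horth : ∑ k, Bᵀ.mulVec (ζ t) k * (μ k - lam t k) = 0 := by
    change Bᵀ.mulVec (ζ t) ⬝ᵥ (μ - lam t) = 0
    rw [Matrix.mulVec_transpose, ← Matrix.dotProduct_mulVec, Matrix.mulVec_sub, hμ,
      eq_neg_of_add_eq_zero_left hfeas, sub_self, dotProduct_zero]
  obtain ⟨k₀, hk₀⟩ := Function.ne_iff.1 hne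
  calc ∑ k, P k (lam t k)
      = ∑ k, (P k (lam t k) + Bᵀ.mulVec (ζ t) k * (μ k - lam t k)) := by
        rw [Finset.sum_add_distrib, horth, add_zero]
    _ < ∑ k, P k (μ k) := by
        refine Finset.sum_lt_sum (fun k _ => ?_) ⟨k₀, Finset.mem_univ _, htangent k₀ hk₀⟩
        by_cases hk : μ k = lam t k
        · simp [hk]
        · exact (htangent k hk).le
end
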